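/- The set of quadruples (a,b,c,d) of smooth functions ℝ² → ℝ satisfying the valence-three Killing tensor equations ∂ₓa = 0, ∂_y a + 3 ∂ₓ b = 0, ∂_y b + ∂ₓ c = 0, 3 ∂_y c + ∂ₓ d = 0, ∂_y d = 0 at every point of ℝ² is a real vector subspace (of the space of quadruples of smooth functions, under pointwise operations) of dimension exactly 10. -/

import Mathlib

/- STATEMENT 1: The set of smooth quadruples (a,b,c,d) satisfying the valence-three
Killing tensor equations on the Euclidean plane is a real vector subspace of the space
of quadruples of functions, of dimension exactly 10. -/

noncomputable section

/-- Partial derivative with respect to the first Cartesian coordinate. -/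
def pdx (f : ℝ × ℝ → ℝ) (p : ℝ × ℝ) : ℝ := fderiv ℝ f p (1, 0)

/-- Partial derivative with respect to the second Cartesian coordinate. -/
def pdy (f : ℝ × ℝ → ℝ) (p : ℝ × ℝ) : ℝ := fderiv ℝ f p (0, 1)

/-- The derivative along a horizontal line is the first partial derivative. -/
theorem hasDerivAt_pdx {f : ℝ × ℝ → ℝ} (hf : Differentiable ℝ f) (x y : ℝ) :
    HasDerivAt (fun t => f (t, y)) (pdx f (x, y)) x :=
  (hf (x, y)).hasFDerivAt.comp_hasDerivAt x ((hasDerivAt_id x).prodMk (hasDerivAt_const x y))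

/-- The derivative along a vertical line is the second partial derivative. -/
theorem hasDerivAt_pdy {f : ℝ × ℝ → ℝ} (hf : Differentiable ℝ f) (x y : ℝ) :
    HasDerivAt (fun t => f (x, t)) (pdy f (x, y)) y :=
  (hf (x, y)).hasFDerivAt.comp_hasDerivAt y ((hasDerivAt_const y x).prodMk (hasDerivAt_id y))

theorem eq_of_hasDerivAt_eq {f g h : ℝ → ℝ} (hf : ∀ t, HasDerivAt f (h t) t)
    (hg : ∀ t, HasDerivAt g (h t) t) (h0 : f 0 = g 0) (t : ℝ) : f t = g t := by
  have hd : ∀ s, HasDerivAt (fun s => f s - g s) 0 s := fun s =>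
    ((hf s).sub (hg s)).congr_deriv (sub_self _)
  have := is_const_of_deriv_eq_zero (fun s => (hd s).differentiableAt) (fun s => (hd s).deriv) t 0
  linarith

theorem hasDerivAt_cubic (k₀ k₁ k₂ k₃ t : ℝ) :
    HasDerivAt (fun t => k₀ + k₁ * t + k₂ * t ^ 2 + k₃ * t ^ 3)
      (k₁ + 2 * k₂ * t + 3 * k₃ * t ^ 2) t := by
  have h := (((hasDerivAt_id t).const_mul k₁).const_add k₀).add
    (((hasDerivAt_id t).pow 2).const_mul k₂) |>.add (((hasDerivAt_id t).pow 3).const_mul k₃)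
  refine h.congr_deriv ?_
  simp
  ring

theorem eq_cubic_of_hasDerivAt {f : ℝ → ℝ} {k₁ k₂ k₃ : ℝ}
    (hf : ∀ t, HasDerivAt f (k₁ + 2 * k₂ * t + 3 * k₃ * t ^ 2) t) (t : ℝ) :
    f t = f 0 + k₁ * t + k₂ * t ^ 2 + k₃ * t ^ 3 :=
  eq_of_hasDerivAt_eq hf (hasDerivAt_cubic (f 0) k₁ k₂ k₃) (by simp) t

theorem pdx_eq_of_cubic {f : ℝ × ℝ → ℝ} (hf : Differentiable ℝ f) {y k₀ k₁ k₂ k₃ : ℝ}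
    (h : ∀ t, f (t, y) = k₀ + k₁ * t + k₂ * t ^ 2 + k₃ * t ^ 3) (x : ℝ) :
    pdx f (x, y) = k₁ + 2 * k₂ * x + 3 * k₃ * x ^ 2 := by
  refine (hasDerivAt_pdx hf x y).unique ?_
  rw [funext h]
  exact hasDerivAt_cubic _ _ _ _ _

theorem pdy_eq_of_cubic {f : ℝ × ℝ → ℝ} (hf : Differentiable ℝ f) {x k₀ k₁ k₂ k₃ : ℝ}
    (h : ∀ t, f (x, t) = k₀ + k₁ * t + k₂ * t ^ 2 + k₃ * t ^ 3) (y : ℝ) :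
    pdy f (x, y) = k₁ + 2 * k₂ * y + 3 * k₃ * y ^ 2 := by
  refine (hasDerivAt_pdy hf x y).unique ?_
  rw [funext h]
  exact hasDerivAt_cubic _ _ _ _ _

theorem contDiff_deriv {f : ℝ → ℝ} (hf : ContDiff ℝ (⊤ : ℕ∞) f) :
    ContDiff ℝ (⊤ : ℕ∞) (deriv f) :=
  (contDiff_infty_iff_deriv.1 hf).2

theorem hasDerivAt_of_contDiff {f : ℝ → ℝ} (hf : ContDiff ℝ (⊤ : ℕ∞) f) (t : ℝ) :
    HasDerivAt f (deriv f t) t :=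
  ((contDiff_infty_iff_deriv.1 hf).1 t).hasDerivAt

theorem eq_cubic_of_deriv_three_const {f : ℝ → ℝ} (hf : ContDiff ℝ (⊤ : ℕ∞) f)
    (h : ∀ t, deriv (deriv (deriv f)) t = deriv (deriv (deriv f)) 0) (t : ℝ) :
    f t = f 0 + deriv f 0 * t + deriv (deriv f) 0 / 2 * t ^ 2
      + deriv (deriv (deriv f)) 0 / 6 * t ^ 3 := by
  have h₂ := eq_cubic_of_hasDerivAt (k₁ := deriv (deriv (deriv f)) 0) (k₂ := 0) (k₃ := 0)
    fun t => by
      convert hasDerivAt_of_contDiff (contDiff_deriv (contDiff_deriv hf)) t using 1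
      linarith [h t]
  have h₁ := eq_cubic_of_hasDerivAt (k₁ := deriv (deriv f) 0)
    (k₂ := deriv (deriv (deriv f)) 0 / 2) (k₃ := 0)
    fun t => by
      convert hasDerivAt_of_contDiff (contDiff_deriv hf) t using 1
      linarith [h₂ t]
  refine eq_cubic_of_hasDerivAt (fun t => ?_) t
  convert hasDerivAt_of_contDiff hf t using 1
  linarith [h₁ t]

/-- The general valence-three Killing tensor of the Euclidean plane, in terms of its
ten coefficients. -/
def killingTensor : (Fin 10 → ℝ) →ₗ[ℝ]
    (ℝ × ℝ → ℝ) × (ℝ × ℝ → ℝ) × (ℝ × ℝ → ℝ) × (ℝ × ℝ → ℝ) where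
  toFun v :=
    (fun p => v 0 + v 1 * p.2 + v 2 * p.2 ^ 2 + v 3 * p.2 ^ 3,
     fun p => (-p.1 * (v 1 + 2 * v 2 * p.2 + 3 * v 3 * p.2 ^ 2)
       + (v 4 + v 5 * p.2 + v 6 * p.2 ^ 2)) / 3,
     fun p => (p.1 ^ 2 * (v 2 + 3 * v 3 * p.2) - p.1 * (v 5 + 2 * v 6 * p.2)
       + (v 7 + v 8 * p.2)) / 3,
     fun p => -p.1 ^ 3 * v 3 + p.1 ^ 2 * v 6 - p.1 * v 8 + v 9)
  map_add' v w := by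
    ext p <;> simp <;> ring
  map_smul' r v := by
    ext p <;> simp <;> ring

theorem killingTensor_injective : Function.Injective killingTensor := by
  refine (injective_iff_map_eq_zero killingTensor).2 fun v hv => ?_
  simp only [killingTensor, LinearMap.coe_mk, AddHom.coe_mk, Prod.mk_eq_zero] at hv
  obtain ⟨ha, hb, hc, hd⟩ := hv
  have a₀ := congrFun ha (0, 0)
  have a₁ := congrFun ha (0, 1)
  have a₂ := congrFun ha (0, -1)
  have a₃ := congrFun ha (0, 2)
  have b₀ := congrFun hb (0, 0)
  have b₁ := congrFun hb (0, 1)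
  have b₂ := congrFun hb (0, -1)
  have c₀ := congrFun hc (0, 0)
  have c₁ := congrFun hc (0, 1)
  have d₀ := congrFun hd (0, 0)
  simp only [Pi.zero_apply] at a₀ a₁ a₂ a₃ b₀ b₁ b₂ c₀ c₁ d₀
  ext i
  fin_cases i <;> simp <;> linarith

/-- A smooth solution of the valence-three Killing tensor equations has the polynomial form
`killingTensor`. -/
theorem mem_range_killingTensor {a b c d : ℝ × ℝ → ℝ} (ha : ContDiff ℝ (⊤ : ℕ∞) a)
    (hb : ContDiff ℝ (⊤ : ℕ∞) b) (hc : ContDiff ℝ (⊤ : ℕ∞) c) (hd : ContDiff ℝ (⊤ : ℕ∞) d)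
    (h : ∀ p : ℝ × ℝ, pdx a p = 0 ∧ pdy a p + 3 * pdx b p = 0 ∧ pdy b p + pdx c p = 0 ∧
      3 * pdy c p + pdx d p = 0 ∧ pdy d p = 0) :
    (a, b, c, d) ∈ LinearMap.range killingTensor := by
  have slice {f : ℝ × ℝ → ℝ} (hf : ContDiff ℝ (⊤ : ℕ∞) f) :
      ContDiff ℝ (⊤ : ℕ∞) (fun y => f (0, y)) :=
    hf.comp (contDiff_const.prodMk contDiff_id)
  have diff {f : ℝ × ℝ → ℝ} (hf : ContDiff ℝ (⊤ : ℕ∞) f) : Differentiable ℝ f :=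
    hf.differentiable (by simp)
  set A : ℝ → ℝ := fun y => a (0, y)
  set B : ℝ → ℝ := fun y => b (0, y)
  set C : ℝ → ℝ := fun y => c (0, y)
  have sA : ContDiff ℝ (⊤ : ℕ∞) A := slice ha
  have sB : ContDiff ℝ (⊤ : ℕ∞) B := slice hb
  have sC : ContDiff ℝ (⊤ : ℕ∞) C := slice hc
  have ea (x y : ℝ) : a (x, y) = A y := by
    rw [eq_cubic_of_hasDerivAt (k₁ := 0) (k₂ := 0) (k₃ := 0) (f := fun t => a (t, y))
      (fun t => by
        convert hasDerivAt_pdx (diff ha) t y using 1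
        rw [(h (t, y)).1]; ring) x]
    ring
  have day (x y : ℝ) : pdy a (x, y) = deriv A y := by
    refine (hasDerivAt_pdy (diff ha) x y).unique ?_
    rw [funext (ea x)]
    exact hasDerivAt_of_contDiff sA y
  have eb (x y : ℝ) : b (x, y) = B y - x * deriv A y / 3 := by
    rw [eq_cubic_of_hasDerivAt (k₁ := -deriv A y / 3) (k₂ := 0) (k₃ := 0)
      (f := fun t => b (t, y))
      (fun t => by
        convert hasDerivAt_pdx (diff hb) t y using 1
        linarith [(h (t, y)).2.1, day t y]) x]
    ring
  have dby (x y : ℝ) : pdy b (x, y) = deriv B y - x * deriv (deriv A) y / 3 := by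
    refine (hasDerivAt_pdy (diff hb) x y).unique ?_
    rw [funext (eb x)]
    exact (hasDerivAt_of_contDiff sB y).sub
      (((hasDerivAt_of_contDiff (contDiff_deriv sA) y).const_mul x).div_const 3)
  have ec (x y : ℝ) : c (x, y) = C y - x * deriv B y + x ^ 2 * deriv (deriv A) y / 6 := by
    rw [eq_cubic_of_hasDerivAt (k₁ := -deriv B y) (k₂ := deriv (deriv A) y / 6) (k₃ := 0)
      (f := fun t => c (t, y))
      (fun t => by
        convert hasDerivAt_pdx (diff hc) t y using 1
        linarith [(h (t, y)).2.2.1, dby t y]) x]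
    ring
  have dcy (x y : ℝ) : pdy c (x, y) =
      deriv C y - x * deriv (deriv B) y + x ^ 2 * deriv (deriv (deriv A)) y / 6 := by
    refine (hasDerivAt_pdy (diff hc) x y).unique ?_
    rw [funext (ec x)]
    exact ((hasDerivAt_of_contDiff sC y).sub
      ((hasDerivAt_of_contDiff (contDiff_deriv sB) y).const_mul x)).add
      (((hasDerivAt_of_contDiff (contDiff_deriv (contDiff_deriv sA)) y).const_mul
        (x ^ 2)).div_const 6)
  have ed (x y : ℝ) : d (x, y) = d (0, y) - 3 * x * deriv C y
      + 3 / 2 * x ^ 2 * deriv (deriv B) y - x ^ 3 * deriv (deriv (deriv A)) y / 6 := by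
    rw [eq_cubic_of_hasDerivAt (k₁ := -3 * deriv C y) (k₂ := 3 / 2 * deriv (deriv B) y)
      (k₃ := -deriv (deriv (deriv A)) y / 6) (f := fun t => d (t, y))
      (fun t => by
        convert hasDerivAt_pdx (diff hd) t y using 1
        linarith [(h (t, y)).2.2.2.1, dcy t y]) x]
    ring
  have ed' (x y : ℝ) : d (x, y) = d (x, 0) := by
    rw [eq_cubic_of_hasDerivAt (k₁ := 0) (k₂ := 0) (k₃ := 0) (f := fun t => d (x, t))
      (fun t => by
        convert hasDerivAt_pdy (diff hd) x t using 1
        rw [(h (x, t)).2.2.2.2]; ring) y]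
    ring
  have comparison (x y : ℝ) := (ed x y).symm.trans ((ed' x y).trans (ed x 0))
  have A₃ (y : ℝ) : deriv (deriv (deriv A)) y = deriv (deriv (deriv A)) 0 := by
    linarith [comparison 1 y, comparison (-1) y, comparison 2 y, ed' 0 y]
  have B₂ (y : ℝ) : deriv (deriv B) y = deriv (deriv B) 0 := by
    linarith [comparison 1 y, comparison (-1) y, comparison 2 y, ed' 0 y]
  have C₁ (y : ℝ) : deriv C y = deriv C 0 := by
    linarith [comparison 1 y, comparison (-1) y, comparison 2 y, ed' 0 y]
  have dA := eq_cubic_of_deriv_three_const sA A₃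
  have dB := eq_cubic_of_deriv_three_const sB fun t => by rw [funext B₂]; simp
  have dC := eq_cubic_of_deriv_three_const sC fun t => by rw [funext C₁]; simp
  rw [funext B₂] at dB
  rw [funext C₁] at dC
  simp only [deriv_const'] at dB dC
  have dA₁ (y : ℝ) := eq_cubic_of_deriv_three_const (contDiff_deriv sA) (fun t => by
    rw [funext A₃]; simp) y
  have dA₂ (y : ℝ) := eq_cubic_of_deriv_three_const (contDiff_deriv (contDiff_deriv sA))
    (fun t => by rw [funext A₃]; simp) y
  have dB₁ (y : ℝ) := eq_cubic_of_deriv_three_const (contDiff_deriv sB)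
    (fun t => by rw [funext B₂]; simp) y
  rw [funext A₃] at dA₁ dA₂
  rw [funext B₂] at dB₁
  simp only [deriv_const'] at dA₁ dA₂ dB₁
  refine ⟨![A 0, deriv A 0, deriv (deriv A) 0 / 2, deriv (deriv (deriv A)) 0 / 6,
    3 * B 0, 3 * deriv B 0, 3 * deriv (deriv B) 0 / 2, 3 * C 0, 3 * deriv C 0, d (0, 0)], ?_⟩
  simp only [killingTensor, LinearMap.coe_mk, AddHom.coe_mk, Prod.mk.injEq]
  refine ⟨?_, ?_, ?_, ?_⟩ <;> ext ⟨x, y⟩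
  · rw [ea, dA y]
    simp
  · rw [eb, dB y, dA₁ y]
    simp
    ring
  · rw [ec, dC y, dB₁ y, dA₂ y]
    simp
    ring
  · rw [ed' x y, ed x 0]
    simp
    ring

theorem killingTensor_mem (v : Fin 10 → ℝ) :
    let q := killingTensor v
    ContDiff ℝ (⊤ : ℕ∞) q.1 ∧ ContDiff ℝ (⊤ : ℕ∞) q.2.1 ∧
      ContDiff ℝ (⊤ : ℕ∞) q.2.2.1 ∧ ContDiff ℝ (⊤ : ℕ∞) q.2.2.2 ∧
      ∀ p : ℝ × ℝ,
        pdx q.1 p = 0 ∧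
        pdy q.1 p + 3 * pdx q.2.1 p = 0 ∧
        pdy q.2.1 p + pdx q.2.2.1 p = 0 ∧
        3 * pdy q.2.2.1 p + pdx q.2.2.2 p = 0 ∧
        pdy q.2.2.2 p = 0 := by
  intro q
  have ha : ContDiff ℝ (⊤ : ℕ∞) q.1 := by
    simp only [q, killingTensor, LinearMap.coe_mk, AddHom.coe_mk]; fun_prop
  have hb : ContDiff ℝ (⊤ : ℕ∞) q.2.1 := by
    simp only [q, killingTensor, LinearMap.coe_mk, AddHom.coe_mk]; fun_prop
  have hc : ContDiff ℝ (⊤ : ℕ∞) q.2.2.1 := by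
    simp only [q, killingTensor, LinearMap.coe_mk, AddHom.coe_mk]; fun_prop
  have hd : ContDiff ℝ (⊤ : ℕ∞) q.2.2.2 := by
    simp only [q, killingTensor, LinearMap.coe_mk, AddHom.coe_mk]; fun_prop
  have diff {f : ℝ × ℝ → ℝ} (hf : ContDiff ℝ (⊤ : ℕ∞) f) : Differentiable ℝ f :=
    hf.differentiable (by simp)
  refine ⟨ha, hb, hc, hd, fun ⟨x, y⟩ => ?_⟩
  rw [pdx_eq_of_cubic (diff ha) (k₀ := v 0 + v 1 * y + v 2 * y ^ 2 + v 3 * y ^ 3)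
      (k₁ := 0) (k₂ := 0) (k₃ := 0) (fun t => by simp [q, killingTensor]),
    pdy_eq_of_cubic (diff ha) (k₀ := v 0) (k₁ := v 1) (k₂ := v 2) (k₃ := v 3)
      (fun t => by simp [q, killingTensor]),
    pdx_eq_of_cubic (diff hb) (k₀ := (v 4 + v 5 * y + v 6 * y ^ 2) / 3)
      (k₁ := -(v 1 + 2 * v 2 * y + 3 * v 3 * y ^ 2) / 3) (k₂ := 0) (k₃ := 0)
      (fun t => by simp [q, killingTensor]; ring),
    pdy_eq_of_cubic (diff hb) (k₀ := (v 4 - x * v 1) / 3) (k₁ := (v 5 - 2 * x * v 2) / 3)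
      (k₂ := (v 6 - 3 * x * v 3) / 3) (k₃ := 0)
      (fun t => by simp [q, killingTensor]; ring),
    pdx_eq_of_cubic (diff hc) (k₀ := (v 7 + v 8 * y) / 3) (k₁ := -(v 5 + 2 * v 6 * y) / 3)
      (k₂ := (v 2 + 3 * v 3 * y) / 3) (k₃ := 0)
      (fun t => by simp [q, killingTensor]; ring),
    pdy_eq_of_cubic (diff hc) (k₀ := (x ^ 2 * v 2 - x * v 5 + v 7) / 3)
      (k₁ := (3 * x ^ 2 * v 3 - 2 * x * v 6 + v 8) / 3) (k₂ := 0) (k₃ := 0)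
      (fun t => by simp [q, killingTensor]; ring),
    pdx_eq_of_cubic (diff hd) (k₀ := v 9) (k₁ := -v 8) (k₂ := v 6) (k₃ := -v 3)
      (fun t => by simp [q, killingTensor]; ring),
    pdy_eq_of_cubic (diff hd) (k₀ := -x ^ 3 * v 3 + x ^ 2 * v 6 - x * v 8 + v 9)
      (k₁ := 0) (k₂ := 0) (k₃ := 0) (fun t => by simp [q, killingTensor])]
  refine ⟨?_, ?_, ?_, ?_, ?_⟩ <;> ring

theorem killing_tensor_valence_three_dimension_ten :
    ∃ S : Submodule ℝ ((ℝ × ℝ → ℝ) × (ℝ × ℝ → ℝ) × (ℝ × ℝ → ℝ) × (ℝ × ℝ → ℝ)),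
      (S : Set ((ℝ × ℝ → ℝ) × (ℝ × ℝ → ℝ) × (ℝ × ℝ → ℝ) × (ℝ × ℝ → ℝ))) =
        {q | ContDiff ℝ (⊤ : ℕ∞) q.1 ∧ ContDiff ℝ (⊤ : ℕ∞) q.2.1 ∧
             ContDiff ℝ (⊤ : ℕ∞) q.2.2.1 ∧ ContDiff ℝ (⊤ : ℕ∞) q.2.2.2 ∧
             ∀ p : ℝ × ℝ,
               pdx q.1 p = 0 ∧
               pdy q.1 p + 3 * pdx q.2.1 p = 0 ∧
               pdy q.2.1 p + pdx q.2.2.1 p = 0 ∧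
               3 * pdy q.2.2.1 p + pdx q.2.2.2 p = 0 ∧
               pdy q.2.2.2 p = 0} ∧
      Module.finrank ℝ S = 10 := by
  refine ⟨LinearMap.range killingTensor, Set.Subset.antisymm ?_ ?_, ?_⟩
  · rintro _ ⟨v, rfl⟩
    exact killingTensor_mem v
  · rintro ⟨a, b, c, d⟩ ⟨ha, hb, hc, hd, h⟩
    exact mem_range_killingTensor ha hb hc hd h
  · rw [LinearMap.finrank_range_of_inj killingTensor_injective]
    simp
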